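/- arXiv:2502.12042 — 3 statements merged into one kernel-verified Lean document; each statement's English description precedes it below -/
import Mathlib

section
/- If an outcome a : N → M of a singleton congestion game minimizes the total cost c̄(a) = ∑_{i∈N} f(n_{a(i)}(a)) over all outcomes, then a is evenly distributed, i.e., |n_x(a) − n_y(a)| ≤ 1 for all resources x, y ∈ M. -/
/-- The load of resource `x` under outcome `a`: the number of players choosing `x`. -/
def load {N M : Type*} [Fintype N] [DecidableEq M] (a : N → M) (x : M) : ℕ :=
  (Finset.univ.filter fun i => a i = x).card

/-- The total cost of an outcome. -/
def totalCost {N M : Type*} [Fintype N] [DecidableEq M] (f : ℕ → ℚ) (a : N → M) : ℚ :=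
  ∑ i, f (load a (a i))

/-- The total cost, summed over resources instead of players. -/
theorem totalCost_eq_sum_load_mul {N M : Type*} [Fintype N] [Fintype M] [DecidableEq M]
    (f : ℕ → ℚ) (a : N → M) :
    totalCost f a = ∑ z, (load a z : ℚ) * f (load a z) := by
  rw [totalCost, ← Finset.sum_fiberwise' Finset.univ a fun z => f (load a z)]
  simp [load]

theorem load_update_self {N M : Type*} [Fintype N] [DecidableEq N] [DecidableEq M]
    (a : N → M) {i : N} {y : M} (hy : a i ≠ y) :
    load (Function.update a i y) y = load a y + 1 := by
  have h : (Finset.univ.filter fun j => Function.update a i y j = y) =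
      insert i (Finset.univ.filter fun j => a j = y) := by
    ext j
    by_cases hj : j = i <;> simp [Function.update_apply, hj]
  rw [load, h, Finset.card_insert_of_notMem (by simpa using hy), load]

theorem load_update_of_ne {N M : Type*} [Fintype N] [DecidableEq N] [DecidableEq M]
    (a : N → M) {i : N} {y z : M} (hzx : z ≠ a i) (hzy : z ≠ y) :
    load (Function.update a i y) z = load a z := by
  unfold load
  congr 1
  ext j
  by_cases hj : j = i
  · simp [hj, hzx.symm, hzy.symm]
  · simp [hj]

theorem load_eq_load_update_add_one {N M : Type*} [Fintype N] [DecidableEq N] [DecidableEq M]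
    (a : N → M) {i : N} {y : M} (hy : a i ≠ y) :
    load a (a i) = load (Function.update a i y) (a i) + 1 := by
  simpa using load_update_self (Function.update a i y) (i := i) (y := a i) (by simpa using hy.symm)

/-- The marginal total cost of a resource is strictly increasing in its load. -/
theorem strictMono_marginalCost (f : ℕ → ℚ) (hf_mono : ∀ k, f k < f (k + 1))
    (hf_conv : ∀ k, f (k + 1) - f k ≤ f (k + 2) - f (k + 1)) :
    StrictMono fun k : ℕ => ((k + 1 : ℕ) : ℚ) * f (k + 1) - (k : ℚ) * f k := by
  refine strictMono_nat_of_lt_succ fun k => ?_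
  push_cast
  have hk : (0 : ℚ) ≤ k := k.cast_nonneg
  nlinarith [hf_mono k, hf_mono (k + 1), mul_le_mul_of_nonneg_left (hf_conv k) hk, hf_conv k]

theorem load_le_load_add_one_of_optimal {N M : Type*} [Fintype N] [Fintype M] [DecidableEq M]
    (f : ℕ → ℚ) (hf_mono : ∀ k, f k < f (k + 1))
    (hf_conv : ∀ k, f (k + 1) - f k ≤ f (k + 2) - f (k + 1))
    (a : N → M) (hopt : ∀ a' : N → M, totalCost f a ≤ totalCost f a') (x y : M) :
    load a x ≤ load a y + 1 := by
  classical
  by_contra! hlt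
  obtain ⟨i, hi⟩ : (Finset.univ.filter fun i => a i = x).Nonempty :=
    Finset.card_pos.mp (by change 0 < load a x; omega)
  obtain rfl : a i = x := by simpa using hi
  have hne : a i ≠ y := by
    intro h
    rw [h] at hlt
    omega
  have hx := load_eq_load_update_add_one a hne
  have hy := load_update_self a hne
  have hle := hopt (Function.update a i y)
  rw [totalCost_eq_sum_load_mul, totalCost_eq_sum_load_mul, ← sub_nonneg,
    ← Finset.sum_sub_distrib, Fintype.sum_eq_add (a i) y hne
      (fun z hz => by rw [load_update_of_ne a hz.1 hz.2, sub_self]), hx, hy] at hle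
  have hmarg := strictMono_marginalCost f hf_mono hf_conv
    (show load a y < load (Function.update a i y) (a i) by omega)
  dsimp only at hmarg
  linarith

/-- Any outcome minimizing the total cost is evenly distributed. -/
theorem totalCost_optimal_imp_evenlyDistributed
    {N M : Type*} [Fintype N] [Fintype M] [DecidableEq M] [Nonempty N] [Nonempty M]
    (f : ℕ → ℚ)
    (hf_mono : ∀ k, f k < f (k + 1))
    (hf_conv : ∀ k, f (k + 1) - f k ≤ f (k + 2) - f (k + 1))
    (a : N → M)
    (hopt : ∀ a' : N → M, totalCost f a ≤ totalCost f a') :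
    ∀ x y : M, |(load a x : ℤ) - (load a y : ℤ)| ≤ 1 := by
  intro x y
  have hxy := load_le_load_add_one_of_optimal f hf_mono hf_conv a hopt x y
  have hyx := load_le_load_add_one_of_optimal f hf_mono hf_conv a hopt y x
  rw [abs_le]
  omega
end

section
/- If an outcome a : N → M of a singleton congestion game is evenly distributed (|n_x(a) − n_y(a)| ≤ 1 for all resources x, y ∈ M), then a minimizes the maximum cost ĉ(a) = max_{i∈N} f(n_{a(i)}(a)) over all outcomes a' : N → M. -/
/-- The maximum cost incurred by any player under outcome `a`. -/
def maxCost {N M : Type*} [Fintype N] [Nonempty N] [DecidableEq M]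
    (f : ℕ → ℚ) (a : N → M) : ℚ :=
  Finset.univ.sup' Finset.univ_nonempty fun i => f (load a (a i))

/-- The loads of all resources add up to the number of players. -/
theorem sum_load {N M : Type*} [Fintype N] [Fintype M] [DecidableEq M] (a : N → M) :
    ∑ x, load a x = Fintype.card N :=
  (Finset.card_eq_sum_card_fiberwise fun _ _ => Finset.mem_coe.2 (Finset.mem_univ _)).symm

theorem load_apply_pos {N M : Type*} [Fintype N] [DecidableEq M] (a : N → M) (i : N) :
    0 < load a (a i) :=
  Finset.card_pos.2 ⟨i, by simp⟩

theorem exists_apply_eq_of_load_pos {N M : Type*} [Fintype N] [DecidableEq M] {a : N → M} {x : M}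
    (h : 0 < load a x) : ∃ i, a i = x := by
  obtain ⟨i, hi⟩ := Finset.card_pos.1 h
  exact ⟨i, (Finset.mem_filter.1 hi).2⟩

/-- Every load of an evenly distributed outcome is matched by some load of any other outcome. -/
theorem exists_load_le_load {N M : Type*} [Fintype N] [Fintype M] [DecidableEq M] {a : N → M}
    (heven : ∀ x y : M, |(load a x : ℤ) - (load a y : ℤ)| ≤ 1) (a' : N → M) (x : M) :
    ∃ y, load a x ≤ load a' y := by
  by_contra! h
  have hlt : ∑ y, load a' y < ∑ y, load a y := by
    refine Finset.sum_lt_sum (fun y _ => ?_) ⟨x, Finset.mem_univ x, h x⟩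
    have hy := h y
    have hxy := abs_le.1 (heven x y)
    omega
  rw [sum_load, sum_load] at hlt
  exact lt_irrefl _ hlt

/-- Any evenly distributed outcome minimizes the maximum cost. -/
theorem evenlyDistributed_imp_maxCost_optimal
    {N M : Type*} [Fintype N] [Fintype M] [DecidableEq M] [Nonempty N] [Nonempty M]
    (f : ℕ → ℚ)
    (hf_mono : ∀ k, f k < f (k + 1))
    (hf_conv : ∀ k, f (k + 1) - f k ≤ f (k + 2) - f (k + 1))
    (a : N → M)
    (heven : ∀ x y : M, |(load a x : ℤ) - (load a y : ℤ)| ≤ 1) :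
    ∀ a' : N → M, maxCost f a ≤ maxCost f a' := by
  intro a'
  refine Finset.sup'_le _ _ fun i _ => ?_
  obtain ⟨y, hy⟩ := exists_load_le_load heven a' (a i)
  obtain ⟨j, rfl⟩ := exists_apply_eq_of_load_pos ((load_apply_pos a i).trans_le hy)
  exact ((strictMono_nat_of_lt_succ hf_mono).monotone hy).trans
    (Finset.le_sup' (fun j => f (load a' (a' j))) (Finset.mem_univ j))
end

section
/- A ĉ-optimal outcome need not be evenly distributed: let n = m·y + l with y ≥ 1, 1 ≤ l, and l ≤ m − 2, and let f : ℕ → ℚ be strictly increasing and convex. Then there exists an outcome a : N → M (|N| = n, |M| = m) that minimizes the maximum cost ĉ(a) = max_{i∈N} f(n_{a(i)}(a)) over all outcomes but is not evenly distributed, i.e., there exist resources x, y ∈ M with n_x(a) ≥ n_y(a) + 2. -/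
/-- Every load profile with the right total is realized by some outcome. -/
theorem exists_load_eq {N M : Type*} [Fintype N] [Fintype M] [DecidableEq M]
    (c : M → ℕ) (hc : ∑ x, c x = Fintype.card N) : ∃ a : N → M, ∀ x, load a x = c x := by
  have e : N ≃ Σ x : M, Fin (c x) := Fintype.equivOfCardEq (by simp [hc])
  refine ⟨fun i => (e i).1, fun x => ?_⟩
  have h : Fintype.card {i : N // (e i).1 = x} = Fintype.card (Fin (c x)) :=
    Fintype.card_congr ((e.subtypeEquiv fun _ => Iff.rfl).trans
      (Equiv.sigmaSubtype x))
  rw [load, ← Fintype.card_subtype, h, Fintype.card_fin]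

/-- By pigeonhole, some player pays at least `f (y + 1)` when there are more than
`y` players per resource on average. -/
theorem le_maxCost_of_mul_lt_card {N M : Type*} [Fintype N] [Fintype M] [DecidableEq M]
    [Nonempty N] {f : ℕ → ℚ} (hf : Monotone f) {y : ℕ}
    (h : Fintype.card M * y < Fintype.card N) (a : N → M) : f (y + 1) ≤ maxCost f a := by
  obtain ⟨x, hx⟩ := Fintype.exists_lt_card_fiber_of_mul_lt_card a h
  obtain ⟨i, hi⟩ := Finset.card_pos.mp (Nat.zero_lt_of_lt hx)
  obtain rfl : a i = x := (Finset.mem_filter.mp hi).2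
  exact (hf (Nat.succ_le_of_lt hx)).trans
    (Finset.le_sup' (fun j => f (load a (a j))) (Finset.mem_univ i))

/-- A `ĉ`-optimal outcome need not be evenly distributed: when
`n = m * y + l` with `y ≥ 1`, `1 ≤ l` and `l ≤ m - 2`, there is an outcome minimizing the
maximum cost in which two resources' loads differ by at least `2`. -/
theorem maxCost_optimal_not_evenlyDistributed
    {N M : Type*} [Fintype N] [Fintype M] [DecidableEq M] [Nonempty N] [Nonempty M]
    (f : ℕ → ℚ)
    (hf_mono : ∀ k, f k < f (k + 1))
    (hf_conv : ∀ k, f (k + 1) - f k ≤ f (k + 2) - f (k + 1))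
    (m y l : ℕ)
    (hM : Fintype.card M = m)
    (hN : Fintype.card N = m * y + l)
    (hy : 1 ≤ y) (hl : 1 ≤ l) (hlm : l + 2 ≤ m) :
    ∃ a : N → M,
      (∀ a' : N → M, maxCost f a ≤ maxCost f a') ∧
      (∃ x z : M, load a z + 2 ≤ load a x) := by
  have hf : Monotone f := monotone_nat_of_le_succ fun k => (hf_mono k).le
  obtain ⟨S, -, hS⟩ := Finset.exists_subset_card_eq
    (s := (Finset.univ : Finset M)) (n := l + 1) (by rw [Finset.card_univ]; omega)
  obtain ⟨z, hz⟩ : ∃ z, z ∉ S := by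
    by_contra! h
    rw [Finset.eq_univ_iff_forall.mpr h, Finset.card_univ] at hS
    omega
  obtain ⟨x, hx⟩ : S.Nonempty := Finset.card_pos.mp (by omega)
  let c : M → ℕ := fun w => if w ∈ S then y + 1 else if w = z then y - 1 else y
  have hc : ∑ w, c w = Fintype.card N := by
    have h : ∑ w, (c w + if w = z then 1 else 0) = ∑ w, (y + if w ∈ S then 1 else 0) := by
      refine Finset.sum_congr rfl fun w _ => ?_
      by_cases hw : w ∈ S
      · have : w ≠ z := fun h => hz (h ▸ hw)
        simp [c, hw, this]
      · by_cases hwz : w = z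
        · simp only [c, hwz, hz, if_true, if_false]
          omega
        · simp [c, hw, hwz]
    simp only [Finset.sum_add_distrib, Finset.sum_ite_eq', Finset.mem_univ, if_true,
      Finset.sum_const, Finset.card_univ, smul_eq_mul, Finset.sum_boole,
      Finset.filter_univ_mem, Nat.cast_id, hM, hS] at h
    omega
  obtain ⟨a, ha⟩ := exists_load_eq c hc
  refine ⟨a, fun a' => le_trans (Finset.sup'_le _ _ fun i _ => hf ?_)
    (le_maxCost_of_mul_lt_card hf (y := y) (by rw [hM]; omega) a'), x, z, ?_⟩
  · rw [ha]
    dsimp only [c]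
    split_ifs <;> omega
  · rw [ha, ha]
    simp only [c, hx, hz, if_true, if_false]
    omega
end
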